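/- arXiv:1403.0199 — 2 statements merged into one kernel-verified Lean document; each statement's English description precedes it below -/
import Mathlib

section
/- Let a, γ, ω > 0 and -1 < p < 0. Then there exist x₀ > 0 and a function φ ∈ C²(ℝ), not identically zero, nonnegative, even and nonincreasing on [0,∞), with φ, φ', φ'' bounded, whose support equals [-x₀, x₀], satisfying φ''(x) = a φ(x)^{p+1} + ω φ(x) - γ^{-1/3} φ(x)^{5/3} for all x ∈ ℝ, and with max φ = φ(0). Moreover, ψ := -(φ²/γ)^{1/3} is continuously differentiable with bounded derivative, is compactly supported with the same support, and (φ,ψ) satisfies -φ'' + ωφ = -φψ - a φ^{p+1} and φ² = -γψ³ on ℝ; in particular (u,v)(x,t) = (e^{iωt}φ(x), ψ(x)) is a compactly supported standing wave of the Benney system iu_t + u_xx = a|u|^p u + uv, v_t - γ(v³)_x = (|u|²)_x. If in addition -2/3 < p < 0, then φ ∈ C³(ℝ) with φ''' bounded and ψ ∈ C²(ℝ) with ψ'' bounded. -/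
open MeasureTheory Filter

noncomputable section

/-- The long-wave profile `ψ = -(φ²/γ)^{1/3}` determined by `φ² = -γψ³`. -/
def psiOf (γ : ℝ) (φ : ℝ → ℝ) : ℝ → ℝ := fun x => -(((φ x) ^ 2 / γ) ^ ((1:ℝ)/3))


theorem removable (x₀ : ℝ) (g h : ℝ → ℝ) (hg : Continuous g) (hh : Continuous h)
    (hd : ∀ x, x ≠ 0 → x ≠ x₀ → x ≠ -x₀ → HasDerivAt g (h x) x) (x : ℝ) :
    HasDerivAt g (h x) x := by
  have key : ∀ y, g y = g 0 + ∫ t in (0:ℝ)..y, h t := by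
    intro y
    have := integral_eq_of_hasDerivAt_off_countable (a := 0) (b := y) g h
      (s := {0, x₀, -x₀}) (Set.Countable.mono subset_rfl (by simp)) hg.continuousOn
      (by
        rintro t ⟨_, ht⟩
        simp only [Set.mem_insert_iff, Set.mem_singleton_iff, not_or] at ht
        exact hd t ht.1 ht.2.1 ht.2.2) (hh.intervalIntegrable _ _)
    rw [this]; ring
  have h1 : HasDerivAt (fun y => g 0 + ∫ t in (0:ℝ)..y, h t) (h x) x :=
    (intervalIntegral.integral_hasDerivAt_right (hh.intervalIntegrable _ _)
      hh.stronglyMeasurable.stronglyMeasurableAtFilter hh.continuousAt).const_add _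
  exact h1.congr_of_eventuallyEq (Eventually.of_forall key)

theorem even_of_pos (x₀ : ℝ) (g h : ℝ → ℝ) (ge : ∀ x, g (-x) = g x)
    (ho : ∀ x, h (-x) = - h x)
    (hd : ∀ x, 0 < x → x ≠ x₀ → HasDerivAt g (h x) x) :
    ∀ x, x ≠ 0 → x ≠ x₀ → x ≠ -x₀ → HasDerivAt g (h x) x := by
  intro x h0 h1 h2
  rcases lt_or_gt_of_ne h0 with hx | hx
  · have := hd (-x) (by linarith) (fun h => h2 (by linarith))
    have h3 := (HasDerivAt.scomp x this (hasDerivAt_neg x))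
    have : g ∘ Neg.neg = g := by funext y; simp [ge]
    change HasDerivAt (g ∘ Neg.neg) _ x at h3
    rw [this, ho] at h3
    simpa using h3
  · exact hd x hx h1

theorem odd_of_pos (x₀ : ℝ) (g h : ℝ → ℝ) (ge : ∀ x, x ≠ 0 → g (-x) = - g x)
    (ho : ∀ x, h (-x) = h x)
    (hd : ∀ x, 0 < x → x ≠ x₀ → HasDerivAt g (h x) x) :
    ∀ x, x ≠ 0 → x ≠ x₀ → x ≠ -x₀ → HasDerivAt g (h x) x := by
  intro x h0 h1 h2
  rcases lt_or_gt_of_ne h0 with hx | hx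
  · have := hd (-x) (by linarith) (fun h => h2 (by linarith))
    have h3 := (HasDerivAt.scomp x this (hasDerivAt_neg x)).neg
    rw [ho] at h3
    have h4 : HasDerivAt (-(g ∘ Neg.neg)) (h x) x := by simpa using h3
    refine h4.congr_of_eventuallyEq ?_
    filter_upwards [isOpen_ne.mem_nhds h0] with y hy
    simp [ge y hy]
  · exact hd x hx h1

theorem inverse_profile (f : ℝ → ℝ) (M : ℝ) (hM : 0 < M) (fpos : ∀ s ∈ Set.Ioo 0 M, 0 < f s)
    (fc : ContinuousOn f (Set.Ioo 0 M)) (fi : IntervalIntegrable f volume 0 M) :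
    ∃ x₀ > 0, ∃ φ : ℝ → ℝ, Continuous φ ∧ (∀ x, 0 ≤ φ x) ∧ (∀ x, φ (-x) = φ x) ∧
      AntitoneOn φ (Set.Ici 0) ∧ φ 0 = M ∧ (∀ x, x₀ ≤ |x| → φ x = 0) ∧
      ∀ x ∈ Set.Ioo 0 x₀, φ x ∈ Set.Ioo 0 M ∧ HasDerivAt φ (-(f (φ x))⁻¹) x := by
  classical
  set F : ℝ → ℝ := fun s => if s ∈ Set.Ioo 0 M then f s else 1 with hF
  have Fpos : ∀ s, 0 < F s := by
    intro s; simp only [hF]; split_ifs with h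
    · exact fpos s h
    · exact one_pos
  have FL : ∀ b c, IntervalIntegrable F volume b c := by
    have : LocallyIntegrable F volume := by
      have e : F = fun s => (Set.Ioo 0 M).indicator f s + (Set.Ioo 0 M)ᶜ.indicator (fun _ => 1) s := by
        funext s
        by_cases h : s ∈ Set.Ioo 0 M <;> simp only [hF, h, if_true, if_false] <;> simp [Set.indicator, -Set.mem_Ioo, h]
      rw [e]
      refine LocallyIntegrable.add (Integrable.locallyIntegrable ?_) ?_
      · rw [integrable_indicator_iff measurableSet_Ioo]
        exact ((intervalIntegrable_iff_integrableOn_Ioo_of_le hM.le).1 fi)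
      · exact (locallyIntegrable_const (1:ℝ)).indicator measurableSet_Ioo.compl
    intro b c
    exact (this.integrableOn_isCompact isCompact_uIcc).intervalIntegrable
  set S : ℝ → ℝ := fun s => ∫ t in (0:ℝ)..s, F t with hS
  have Sdiff : ∀ b c, S c - S b = ∫ t in b..c, F t := fun b c =>
    intervalIntegral.integral_interval_sub_left (FL _ _) (FL _ _)
  have Smono : StrictMono S := by
    intro b c hbc
    have := Sdiff b c
    have h2 := intervalIntegral.intervalIntegral_pos_of_pos (FL b c) Fpos hbc
    linarith
  have Scont : Continuous S := intervalIntegral.continuous_primitive FL 0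
  have S0 : S 0 = 0 := by simp [hS]
  have hx₀ : 0 < S M := by rw [← S0]; exact Smono hM
  have Stop : ∀ s, M ≤ s → S s = S M + (s - M) := by
    intro s hs
    have := Sdiff M s
    have h2 : ∫ t in M..s, F t = ∫ t in M..s, (1:ℝ) := by
      apply intervalIntegral.integral_congr
      intro t ht
      rw [Set.uIcc_of_le hs] at ht
      simp only [hF]; rw [if_neg]; rintro ⟨_, h⟩; linarith [ht.1]
    rw [h2] at this; simp at this; linarith
  have Sbot : ∀ s, s ≤ 0 → S s = s := by
    intro s hs
    have h2 : S s = ∫ t in (0:ℝ)..s, (1:ℝ) := by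
      apply intervalIntegral.integral_congr
      intro t ht
      rw [Set.uIcc_of_ge hs] at ht
      simp only [hF]; rw [if_neg]; rintro ⟨h, _⟩; linarith [ht.2]
    rw [h2]; simp
  have Ssurj : Function.Surjective S := by
    apply Scont.surjective
    · refine tendsto_atTop_mono' (f₁ := fun s => S M + (s - M)) _ ?_ ?_
      · filter_upwards [eventually_ge_atTop M] with s hs using (Stop s hs).ge
      · exact tendsto_atTop_add_const_left _ _ (tendsto_atTop_add_const_right _ _ tendsto_id)
    · refine tendsto_atBot_mono' _ ?_ (tendsto_id (α := ℝ))
      filter_upwards [eventually_le_atBot 0] with s hs using (Sbot s hs).le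
  let e : ℝ ≃o ℝ := StrictMono.orderIsoOfSurjective S Smono Ssurj
  have eS : ∀ s, e s = S s := fun s => rfl
  have e0 : e.symm 0 = 0 := by rw [OrderIso.symm_apply_eq, eS, S0]
  have eM : e.symm (S M) = M := by rw [OrderIso.symm_apply_eq, eS]
  refine ⟨S M, hx₀, fun x => max 0 (e.symm (S M - |x|)), ?_, ?_, ?_, ?_, ?_, ?_, ?_⟩
  · have := e.symm.continuous
    fun_prop
  · intro x; exact le_max_left _ _
  · intro x; simp
  · intro x hx y hy hxy
    simp only [Set.mem_Ici] at hx hy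
    apply max_le_max le_rfl
    apply e.symm.monotone
    rw [abs_of_nonneg hx, abs_of_nonneg hy]; linarith
  · simp [eM, hM.le]
  · intro x hx
    apply max_eq_left
    rw [← e0]; apply e.symm.monotone; linarith
  · rintro x ⟨h0, h1⟩
    have hpos : 0 < e.symm (S M - x) := by
      rw [← e0]; apply e.symm.strictMono; linarith
    have hlt : e.symm (S M - x) < M := by
      conv_rhs => rw [← eM]
      apply e.symm.strictMono; linarith
    have hv : max 0 (e.symm (S M - |x|)) = e.symm (S M - x) := by
      rw [abs_of_pos h0, max_eq_right hpos.le]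
    have hmem : e.symm (S M - x) ∈ Set.Ioo 0 M := ⟨hpos, hlt⟩
    simp only [hv]
    refine ⟨hmem, ?_⟩
    have nb : Set.Ioo 0 M ∈ nhds (e.symm (S M - x)) := isOpen_Ioo.mem_nhds hmem
    have Fe : F =ᶠ[nhds (e.symm (S M - x))] f := by
      filter_upwards [nb] with s hs
      simp only [hF]; rw [if_pos hs]
    have FcO : ContinuousOn F (Set.Ioo 0 M) := fc.congr (fun s hs => by simp only [hF]; rw [if_pos hs])
    have dS : HasDerivAt S (f (e.symm (S M - x))) (e.symm (S M - x)) := by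
      rw [← Fe.eq_of_nhds]
      exact intervalIntegral.integral_hasDerivAt_right (FL _ _)
        (FcO.stronglyMeasurableAtFilter isOpen_Ioo _ hmem) (FcO.continuousAt nb)
    have dI : HasDerivAt e.symm (f (e.symm (S M - x)))⁻¹ (S M - x) :=
      HasDerivAt.of_local_left_inverse e.symm.continuous.continuousAt dS (fpos _ hmem).ne'
        (Eventually.of_forall fun y => e.apply_symm_apply y)
    have dC := HasDerivAt.scomp x dI ((hasDerivAt_id x).const_sub (S M))
    have : HasDerivAt (fun y => e.symm (S M - y)) (-(f (e.symm (S M - x)))⁻¹) x := by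
      simpa [Function.comp_def] using dC
    refine this.congr_of_eventuallyEq ?_
    have n2 : ∀ᶠ y in nhds x, 0 < e.symm (S M - y) :=
      (this.continuousAt).eventually (lt_mem_nhds hpos)
    filter_upwards [n2, lt_mem_nhds h0] with y hy hy0
    rw [abs_of_pos hy0, max_eq_right hy.le]

/-- `G(s) s^{2r-2}` where `G` is the potential energy. -/
def Pf (A B k p r s : ℝ) : ℝ := A * s ^ (p + 2 * r) + B * s ^ (2 * r) - k * s ^ (2 * r + 2 / 3)

/-- second derivative function -/
def Sf (A B k p r s : ℝ) : ℝ := A * (p + 2 * r) * s ^ (p + r) + B * (2 * r) * s ^ r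
  - k * (2 * r + 2 / 3) * s ^ (r + 2 / 3)

/-- derivative of `φ^r`, up to the factor `r` -/
def Df (A B k p : ℝ) (φ : ℝ → ℝ) (r x : ℝ) : ℝ :=
  if 0 ≤ x then -√(2 * Pf A B k p r (φ x)) else √(2 * Pf A B k p r (φ x))

theorem Pf_scale (A B k p r s : ℝ) (hs : 0 < s) :
    Pf A B k p r s = Pf A B k p 1 s * s ^ (2 * r - 2) := by
  unfold Pf
  rw [sub_mul, add_mul, mul_assoc, mul_assoc, mul_assoc, ← Real.rpow_add hs, ← Real.rpow_add hs,
    ← Real.rpow_add hs]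
  ring_nf

theorem sqrt_Pf_scale (A B k p r s : ℝ) (hs : 0 < s) :
    √(2 * Pf A B k p r s) = √(2 * Pf A B k p 1 s) * s ^ (r - 1) := by
  rw [Pf_scale _ _ _ _ _ _ hs, ← mul_assoc, mul_comm, Real.sqrt_mul (by positivity), mul_comm]
  congr 1
  rw [Real.sqrt_eq_rpow, ← Real.rpow_mul hs.le]
  congr 1; ring

theorem hasDeriv_Pf (A B k p r s : ℝ) (hs : 0 < s) :
    HasDerivAt (Pf A B k p r) (Sf A B k p r s * s ^ (r - 1)) s := by
  have h := (((Real.hasDerivAt_rpow_const (p := p + 2 * r) (Or.inl hs.ne')).const_mul A).add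
    ((Real.hasDerivAt_rpow_const (p := 2 * r) (Or.inl hs.ne')).const_mul B)).sub
    ((Real.hasDerivAt_rpow_const (p := 2 * r + 2 / 3) (Or.inl hs.ne')).const_mul k)
  refine h.congr_deriv ?_
  unfold Sf
  have e1 : s ^ (p + 2 * r - 1) = s ^ (p + r) * s ^ (r - 1) := by
    rw [← Real.rpow_add hs]; ring_nf
  have e2 : s ^ (2 * r - 1) = s ^ r * s ^ (r - 1) := by
    rw [← Real.rpow_add hs]; ring_nf
  have e3 : s ^ (2 * r + 2 / 3 - 1) = s ^ (r + 2 / 3) * s ^ (r - 1) := by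
    rw [← Real.rpow_add hs]; ring_nf
  rw [e1, e2, e3]
  ring

section
variable {A B k p M x₀ : ℝ} {φ : ℝ → ℝ}

theorem Df_cont (φc : Continuous φ) (φ0 : φ 0 = M) (hM : 0 < M)
    (PM : Pf A B k p 1 M = 0) (r : ℝ) (hr : 0 < r) (hpr : 0 < p + 2 * r) :
    Continuous (Df A B k p φ r) := by
  have c1 : Continuous fun x => Pf A B k p r (φ x) := by
    unfold Pf
    have h1 := φc.rpow_const (p := p + 2 * r) (fun _ => Or.inr hpr.le)
    have h2 := φc.rpow_const (p := 2 * r) (fun _ => Or.inr (by linarith))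
    have h3 := φc.rpow_const (p := 2 * r + 2 / 3) (fun _ => Or.inr (by linarith))
    fun_prop
  refine Continuous.if_le (by fun_prop) (by fun_prop) continuous_const continuous_id ?_
  intro x hx
  subst hx
  rw [φ0, Pf_scale _ _ _ _ _ _ hM, PM]; simp

theorem Df_zero (hφ : ∀ x, x₀ ≤ |x| → φ x = 0) (r : ℝ) (hr : 0 < r) (hpr : 0 < p + 2 * r)
    (x : ℝ) (hx : x₀ ≤ |x|) : Df A B k p φ r x = 0 := by
  unfold Df Pf
  rw [hφ x hx, Real.zero_rpow hpr.ne', Real.zero_rpow (by linarith), Real.zero_rpow (by linarith)]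
  simp

theorem first_deriv (φc : Continuous φ) (φe : ∀ x, φ (-x) = φ x) (φ0 : φ 0 = M)
    (hM : 0 < M)
    (PM : Pf A B k p 1 M = 0) (hz : ∀ x, x₀ ≤ |x| → φ x = 0)
    (hd : ∀ x ∈ Set.Ioo 0 x₀, φ x ∈ Set.Ioo 0 M ∧ HasDerivAt φ (-√(2 * Pf A B k p 1 (φ x))) x)
    (r : ℝ) (hr : 0 < r) (hpr : 0 < p + 2 * r) (x : ℝ) :
    HasDerivAt (fun x => φ x ^ r) (r * Df A B k p φ r x) x := by
  have Dc := Df_cont φc φ0 hM PM r hr hpr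
  refine removable x₀ _ (fun x => r * Df A B k p φ r x) (φc.rpow_const (fun _ => Or.inr hr.le))
    (by fun_prop) ?_ x
  refine even_of_pos x₀ _ _ (fun x => by simp only [φe]) ?_ ?_
  · intro x
    rcases lt_trichotomy x 0 with h | h | h
    · simp [Df, φe, h.le, not_le.2 h]
    · subst h; simp [Df, φ0, Pf_scale A B k p r M hM, PM]
    · simp [Df, φe, h.le, not_le.2 h]
  · intro x h0 h1
    rcases lt_or_gt_of_ne h1 with h | h
    · obtain ⟨hm, hd'⟩ := hd x ⟨h0, h⟩
      have := hd'.rpow_const (p := r) (Or.inl hm.1.ne')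
      refine this.congr_deriv ?_
      rw [Df, if_pos h0.le, sqrt_Pf_scale A B k p r _ hm.1]
      ring
    · rw [Df_zero hz r hr hpr x (by rw [abs_of_pos h0]; exact h.le), mul_zero]
      refine (hasDerivAt_const x (0:ℝ)).congr_of_eventuallyEq ?_
      filter_upwards [lt_mem_nhds h] with y hy
      rw [hz y (hy.le.trans (le_abs_self y)), Real.zero_rpow hr.ne']

theorem Sf_cont (φc : Continuous φ) (r : ℝ) (hr : 0 < r) (hpr : 0 < p + r) :
    Continuous fun x => Sf A B k p r (φ x) := by
  unfold Sf
  have h1 := φc.rpow_const (p := p + r) (fun _ => Or.inr hpr.le)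
  have h2 := φc.rpow_const (p := r) (fun _ => Or.inr (by linarith))
  have h3 := φc.rpow_const (p := r + 2 / 3) (fun _ => Or.inr (by linarith))
  fun_prop

theorem second_deriv (φc : Continuous φ) (φe : ∀ x, φ (-x) = φ x) (φ0 : φ 0 = M)
    (hM : 0 < M)
    (PM : Pf A B k p 1 M = 0) (hz : ∀ x, x₀ ≤ |x| → φ x = 0)
    (hP : ∀ s ∈ Set.Ioo 0 M, 0 < Pf A B k p 1 s)
    (hd : ∀ x ∈ Set.Ioo 0 x₀, φ x ∈ Set.Ioo 0 M ∧ HasDerivAt φ (-√(2 * Pf A B k p 1 (φ x))) x)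
    (r : ℝ) (hr : 0 < r) (hpr : 0 < p + r) (x : ℝ) :
    HasDerivAt (Df A B k p φ r) (Sf A B k p r (φ x)) x := by
  refine removable x₀ _ (fun x => Sf A B k p r (φ x)) (Df_cont φc φ0 hM PM r hr (by linarith))
    (Sf_cont φc r hr hpr) ?_ x
  refine odd_of_pos x₀ _ _ ?_ (fun x => by simp only [φe]) ?_
  · intro x hx
    rcases lt_or_gt_of_ne hx with h | h
    · simp [Df, φe, h.le, not_le.2 h]
    · simp [Df, φe, h.le, not_le.2 h]
  · intro x h0 h1
    rcases lt_or_gt_of_ne h1 with h | h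
    · obtain ⟨hm, hd'⟩ := hd x ⟨h0, h⟩
      have hp := hP _ hm
      have hpow := Real.rpow_pos_of_pos hm.1 (r - 1)
      have hpp : 0 < Pf A B k p r (φ x) := by
        rw [Pf_scale _ _ _ _ _ _ hm.1]
        exact mul_pos hp (Real.rpow_pos_of_pos hm.1 _)
      have e1 := HasDerivAt.comp x (hasDeriv_Pf A B k p r _ hm.1) hd'
      have e2 := ((e1.const_mul 2).sqrt (by simpa using hpp.ne')).neg
      have e3 : HasDerivAt (Df A B k p φ r) _ x := e2.congr_of_eventuallyEq (by
        filter_upwards [lt_mem_nhds h0] with y hy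
        simp [Df, hy.le])
      refine e3.congr_deriv ?_
      simp only [Function.comp]
      rw [sqrt_Pf_scale A B k p r _ hm.1]
      have : 0 < √(2 * Pf A B k p 1 (φ x)) := Real.sqrt_pos.2 (by linarith)
      field_simp
    · have hx := hz x (h.le.trans (le_abs_self x))
      have hS : Sf A B k p r (φ x) = 0 := by
        unfold Sf
        rw [hx, Real.zero_rpow hpr.ne', Real.zero_rpow (by linarith), Real.zero_rpow (by linarith)]
        simp
      rw [hS]
      refine (hasDerivAt_const x (0:ℝ)).congr_of_eventuallyEq ?_
      filter_upwards [lt_mem_nhds h] with y hy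
      exact Df_zero hz r hr (by linarith) y (hy.le.trans (le_abs_self y))
end

theorem exists_M (A B k p : ℝ) (hA : 0 < A) (hB : 0 < B) (hk : 0 < k) (hp1 : -1 < p) (hp0 : p < 0) :
    ∃ M > 0, Pf A B k p 1 M = 0 ∧ ∃ c > 0, ∀ s ∈ Set.Ioo 0 M,
      c * (s ^ (p + 2) * (M - s)) ≤ Pf A B k p 1 s := by
  have hroot : ∃ M > 0, A + B * M ^ (-p) - k * M ^ (2 / 3 - p) = 0 := by
    have hc : Continuous fun s : ℝ => A + B * s ^ (-p) - k * s ^ (2 / 3 - p) := by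
      have h2 := continuous_id.rpow_const (p := -p) (fun _ => Or.inr (by linarith))
      have h3 := continuous_id.rpow_const (p := 2 / 3 - p) (fun _ => Or.inr (by linarith))
      simp only [id] at h2 h3
      fun_prop
    set t : ℝ := max 1 (((A + B) / k) ^ (3 / 2 : ℝ)) with ht
    have t1 : 1 ≤ t := le_max_left _ _
    have t2 : (A + B) / k ≤ t ^ (2 / 3 : ℝ) := by
      have : (A + B) / k = (((A + B) / k) ^ (3 / 2 : ℝ)) ^ (2 / 3 : ℝ) := by
        rw [← Real.rpow_mul (by positivity)]; norm_num
      rw [this]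
      exact Real.rpow_le_rpow (by positivity) (le_max_right _ _) (by norm_num)
    have t3 : A + B ≤ k * t ^ (2 / 3 : ℝ) := by
      rw [div_le_iff₀ hk] at t2; linarith
    have t4 : 1 ≤ t ^ (-p) := Real.one_le_rpow t1 (by linarith)
    have t5 : t ^ (2 / 3 - p) = t ^ (2 / 3 : ℝ) * t ^ (-p) := by
      rw [← Real.rpow_add (by linarith)]; ring_nf
    have ht0 : A + B * t ^ (-p) - k * t ^ (2 / 3 - p) ≤ 0 := by
      rw [t5]; nlinarith
    have h00 : (0:ℝ) ≤ A + B * (0:ℝ) ^ (-p) - k * (0:ℝ) ^ (2 / 3 - p) := by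
      rw [Real.zero_rpow (by linarith), Real.zero_rpow (by linarith)]; simpa using hA.le
    obtain ⟨M, hM, hM'⟩ := intermediate_value_Icc' (by linarith : (0:ℝ) ≤ t) hc.continuousOn ⟨ht0, h00⟩
    refine ⟨M, lt_of_le_of_ne hM.1 ?_, hM'⟩
    rintro rfl
    simp only at hM'
    rw [Real.zero_rpow (by linarith), Real.zero_rpow (by linarith)] at hM'
    linarith
  obtain ⟨M, hM, hM'⟩ := hroot
  have fac : ∀ s : ℝ, 0 < s → Pf A B k p 1 s = s ^ (p + 2) * (A + B * s ^ (-p) - k * s ^ (2 / 3 - p)) := by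
    intro s hs
    unfold Pf
    have e1 : s ^ (2 * 1 : ℝ) = s ^ (p + 2) * s ^ (-p) := by rw [← Real.rpow_add hs]; ring_nf
    have e2 : s ^ (2 * 1 + 2 / 3 : ℝ) = s ^ (p + 2) * s ^ (2 / 3 - p) := by
      rw [← Real.rpow_add hs]; ring_nf
    rw [e1, e2]; ring_nf
  refine ⟨M, hM, by rw [fac M hM, hM', mul_zero], A * (-p) / M, by
    have : 0 < -p := by linarith
    positivity, ?_⟩
  rintro s ⟨h0, h1⟩
  rw [fac s h0]
  have hpos := Real.rpow_pos_of_pos h0 (p + 2)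
  -- with `t = s / M`
  have hb : (s / M) ^ (-p) ≤ 1 + (-p) * (s / M - 1) := by
    have := rpow_one_add_le_one_add_mul_self (s := s / M - 1) (p := -p)
      (by have : 0 < s / M := by positivity
          linarith) (by linarith) (by linarith)
    simpa using this
  have hs : s ^ (-p) = M ^ (-p) * (s / M) ^ (-p) := by
    rw [← Real.mul_rpow hM.le (by positivity)]; congr 1; field_simp
  have hle : s ^ (2 / 3 : ℝ) ≤ M ^ (2 / 3 : ℝ) := Real.rpow_le_rpow h0.le h1.le (by norm_num)
  have es : s ^ (2 / 3 - p) = s ^ (2 / 3 : ℝ) * s ^ (-p) := by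
    rw [← Real.rpow_add h0]; ring_nf
  have eM : M ^ (2 / 3 - p) = M ^ (2 / 3 : ℝ) * M ^ (-p) := by
    rw [← Real.rpow_add hM]; ring_nf
  have q1 : k * s ^ (2 / 3 - p) ≤ k * M ^ (2 / 3 : ℝ) * s ^ (-p) := by
    rw [es, mul_assoc]
    have := Real.rpow_nonneg h0.le (-p)
    gcongr
  -- (k M^{2/3} - B) M^{-p} = A
  have q2 : (k * M ^ (2 / 3 : ℝ) - B) * M ^ (-p) = A := by
    rw [eM] at hM'; linarith
  have q3 : A * (-p) / M * (M - s) ≤ A + B * s ^ (-p) - k * s ^ (2 / 3 - p) := by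
    have : (k * M ^ (2 / 3 : ℝ) - B) * s ^ (-p) = A * (s / M) ^ (-p) := by
      rw [hs, ← mul_assoc, q2]
    have h2 : A * (-p) / M * (M - s) = A * (-p * (1 - s / M)) := by field_simp
    rw [h2]
    nlinarith
  calc _ = s ^ (p + 2) * (A * (-p) / M * (M - s)) := by ring
    _ ≤ _ := by gcongr

theorem time_integrable (A B k p M c : ℝ) (hp1 : -1 < p) (hp0 : p < 0) (hM : 0 < M) (hc : 0 < c)
    (hP : ∀ s ∈ Set.Ioo 0 M, c * (s ^ (p + 2) * (M - s)) ≤ Pf A B k p 1 s) :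
    ContinuousOn (fun s => (√(2 * Pf A B k p 1 s))⁻¹) (Set.Ioo 0 M) ∧
    IntervalIntegrable (fun s => (√(2 * Pf A B k p 1 s))⁻¹) volume 0 M := by
  have hpos : ∀ s ∈ Set.Ioo 0 M, 0 < Pf A B k p 1 s := fun s hs =>
    lt_of_lt_of_le (mul_pos hc (mul_pos (Real.rpow_pos_of_pos hs.1 _) (sub_pos.2 hs.2))) (hP s hs)
  have Pc : ContinuousOn (Pf A B k p 1) (Set.Ioo 0 M) := fun s hs =>
    (hasDeriv_Pf A B k p 1 s hs.1).continuousAt.continuousWithinAt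
  have fc : ContinuousOn (fun s => (√(2 * Pf A B k p 1 s))⁻¹) (Set.Ioo 0 M) := by
    refine ContinuousOn.inv₀ (by fun_prop) ?_
    intro s hs
    exact (Real.sqrt_pos.2 (by linarith [hpos s hs])).ne'
  refine ⟨fc, ?_⟩
  have i1 : IntervalIntegrable (fun s : ℝ => s ^ (-(p + 2) / 2)) volume 0 M :=
    intervalIntegral.intervalIntegrable_rpow' (by linarith)
  have i2 : IntervalIntegrable (fun s : ℝ => (M - s) ^ (-(1:ℝ) / 2)) volume 0 M := by
    have := (intervalIntegral.intervalIntegrable_rpow' (a := 0) (b := M)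
      (show (-1:ℝ) < -(1:ℝ) / 2 by norm_num)).comp_sub_left M
    simpa using this.symm
  have i3 := ((i1.const_mul ((M / 2) ^ (-(1:ℝ) / 2))).add
    (i2.const_mul ((M / 2) ^ (-(p + 2) / 2)))).const_mul ((2 * c) ^ (-(1:ℝ) / 2))
  rw [intervalIntegrable_iff_integrableOn_Ioo_of_le hM.le] at i3 ⊢
  refine Integrable.mono' i3 (fc.aestronglyMeasurable measurableSet_Ioo) ?_
  refine (ae_restrict_iff' measurableSet_Ioo).2 (Eventually.of_forall ?_)
  rintro s ⟨h0, h1⟩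
  have hMs : 0 < M - s := sub_pos.2 h1
  have hq : 0 < s ^ (p + 2) := Real.rpow_pos_of_pos h0 _
  have b1 : (√(2 * Pf A B k p 1 s))⁻¹ ≤ (√(2 * (c * (s ^ (p + 2) * (M - s)))))⁻¹ := by
    apply inv_anti₀
    · apply Real.sqrt_pos.2; positivity
    · apply Real.sqrt_le_sqrt; linarith [hP s ⟨h0, h1⟩]
  have b2 : (√(2 * (c * (s ^ (p + 2) * (M - s)))))⁻¹ =
      (2 * c) ^ (-(1:ℝ) / 2) * (s ^ (-(p + 2) / 2) * (M - s) ^ (-(1:ℝ) / 2)) := by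
    rw [Real.sqrt_eq_rpow, ← Real.rpow_neg (by positivity), ← mul_assoc,
      Real.mul_rpow (by positivity) (by positivity), Real.mul_rpow (by positivity) hMs.le,
      ← Real.rpow_mul h0.le]
    ring_nf
  have n1 : 0 ≤ s ^ (-(p + 2) / 2) := Real.rpow_nonneg h0.le _
  have n2 : 0 ≤ (M - s) ^ (-(1:ℝ) / 2) := Real.rpow_nonneg hMs.le _
  have n3 : 0 ≤ (M / 2) ^ (-(1:ℝ) / 2) := by positivity
  have n4 : 0 ≤ (M / 2) ^ (-(p + 2) / 2) := by positivity
  have b3 : s ^ (-(p + 2) / 2) * (M - s) ^ (-(1:ℝ) / 2) ≤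
      (M / 2) ^ (-(1:ℝ) / 2) * s ^ (-(p + 2) / 2) + (M / 2) ^ (-(p + 2) / 2) * (M - s) ^ (-(1:ℝ) / 2) := by
    rcases le_total s (M / 2) with h | h
    · have : (M - s) ^ (-(1:ℝ) / 2) ≤ (M / 2) ^ (-(1:ℝ) / 2) :=
        Real.rpow_le_rpow_of_nonpos (by positivity) (by linarith) (by norm_num)
      nlinarith [mul_nonneg n4 n2]
    · have : s ^ (-(p + 2) / 2) ≤ (M / 2) ^ (-(p + 2) / 2) :=
        Real.rpow_le_rpow_of_nonpos (by positivity) h (by linarith)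
      nlinarith [mul_nonneg n3 n1]
  rw [Real.norm_of_nonneg (by positivity)]
  refine (b1.trans_eq b2).trans ?_
  gcongr

theorem contDiff_one_of (g g' : ℝ → ℝ) (h : ∀ x, HasDerivAt g (g' x) x) (hc : Continuous g') :
    ContDiff ℝ 1 g := by
  have e : deriv g = g' := funext fun x => (h x).deriv
  exact contDiff_one_iff_deriv.2 ⟨fun x => (h x).differentiableAt, e ▸ hc⟩

theorem contDiff_succ_of (n : ℕ) (g g' : ℝ → ℝ) (h : ∀ x, HasDerivAt g (g' x) x)
    (hc : ContDiff ℝ n g') : ContDiff ℝ (n + 1) g := by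
  have e : deriv g = g' := funext fun x => (h x).deriv
  exact contDiff_succ_iff_deriv.2 ⟨fun x => (h x).differentiableAt, by simp, e ▸ hc⟩

/-- for `-1 < p < 0` and `a, γ, ω > 0`, the Benney system admits a
nontrivial compactly supported standing-wave profile: there are `x₀ > 0` and
`φ ∈ C²(ℝ) ∩ W^{2,∞}`, nonnegative, even, nonincreasing on `[0,∞)`, with
support `[-x₀,x₀]`, maximum at `0`, solving
`φ'' = aφ^{p+1} + ωφ - γ^{-1/3}φ^{5/3}`; moreover `ψ := -(φ²/γ)^{1/3}` is
`C¹ ∩ W^{1,∞}` with the same support and `(φ,ψ)` solves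
`-φ'' + ωφ = -φψ - aφ^{p+1}`, `φ² = -γψ³`. If moreover `-2/3 < p`, then
`φ ∈ C³ ∩ W^{3,∞}` and `ψ ∈ C² ∩ W^{2,∞}`. -/
theorem compact_standing_wave (p a γ ω : ℝ) (hp1 : -1 < p) (hp0 : p < 0)
    (ha : 0 < a) (hγ : 0 < γ) (hω : 0 < ω) :
    ∃ x₀ > (0:ℝ), ∃ φ : ℝ → ℝ,
      φ ≠ 0 ∧
      (∀ x, 0 ≤ φ x) ∧ (∀ x, φ (-x) = φ x) ∧ AntitoneOn φ (Set.Ici 0) ∧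
      ContDiff ℝ 2 φ ∧
      (∃ M, ∀ x, |φ x| ≤ M ∧ |deriv φ x| ≤ M ∧ |deriv (deriv φ) x| ≤ M) ∧
      tsupport φ = Set.Icc (-x₀) x₀ ∧
      (∀ x, deriv (deriv φ) x
        = a * φ x ^ (p + 1) + ω * φ x - γ ^ (-(1:ℝ)/3) * φ x ^ ((5:ℝ)/3)) ∧
      (∀ x, φ x ≤ φ 0) ∧
      (ContDiff ℝ 1 (psiOf γ φ) ∧
        (∃ M, ∀ x, |psiOf γ φ x| ≤ M ∧ |deriv (psiOf γ φ) x| ≤ M) ∧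
        tsupport (psiOf γ φ) = Set.Icc (-x₀) x₀ ∧
        (∀ x, -deriv (deriv φ) x + ω * φ x = -(φ x * psiOf γ φ x) - a * φ x ^ (p + 1)) ∧
        (∀ x, (φ x) ^ 2 = -γ * (psiOf γ φ x) ^ 3)) ∧
      (-(2:ℝ)/3 < p →
        ContDiff ℝ 3 φ ∧ (∃ M, ∀ x, |deriv (deriv (deriv φ)) x| ≤ M) ∧
        ContDiff ℝ 2 (psiOf γ φ) ∧
        (∃ M, ∀ x, |deriv (deriv (psiOf γ φ)) x| ≤ M)) := by
  set g : ℝ := γ ^ (-(1:ℝ)/3) with hg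
  have gpos : 0 < g := Real.rpow_pos_of_pos hγ _
  set A : ℝ := a / (p + 2) with hA
  set B : ℝ := ω / 2 with hB
  set k : ℝ := 3 / 8 * g with hk
  have p2 : 0 < p + 2 := by linarith
  obtain ⟨M, hM, PM, c, hc, hlow⟩ := exists_M A B k p (by positivity) (by positivity)
    (by positivity) hp1 hp0
  have hP : ∀ s ∈ Set.Ioo 0 M, 0 < Pf A B k p 1 s := fun s hs =>
    lt_of_lt_of_le (mul_pos hc (mul_pos (Real.rpow_pos_of_pos hs.1 _) (sub_pos.2 hs.2))) (hlow s hs)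
  obtain ⟨fc, fi⟩ := time_integrable A B k p M c hp1 hp0 hM hc hlow
  obtain ⟨x₀, hx₀, φ, φc, φnn, φe, φa, φ0, hz, hd⟩ := inverse_profile _ M hM
    (fun s hs => inv_pos.2 (Real.sqrt_pos.2 (by linarith [hP s hs]))) fc fi
  simp only [inv_inv] at hd
  have first := first_deriv φc φe φ0 hM PM hz hd
  have second := second_deriv φc φe φ0 hM PM hz hP hd
  have Dc := Df_cont (A := A) (B := B) (k := k) (p := p) φc φ0 hM PM
  have Sc := fun r hr hpr => Sf_cont (A := A) (B := B) (k := k) (p := p) φc r hr hpr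
  -- derivatives of `φ`
  have hφ1 : ∀ x, HasDerivAt φ (Df A B k p φ 1 x) x := by
    intro x; simpa using first 1 one_pos (by linarith) x
  have hφ2 : ∀ x, HasDerivAt (Df A B k p φ 1) (Sf A B k p 1 (φ x)) x :=
    second 1 one_pos (by linarith)
  have d1 : deriv φ = Df A B k p φ 1 := funext fun x => (hφ1 x).deriv
  have d2 : deriv (deriv φ) = fun x => Sf A B k p 1 (φ x) := by
    rw [d1]; exact funext fun x => (hφ2 x).deriv
  have hS : ∀ s, Sf A B k p 1 s = a * s ^ (p + 1) + ω * s - g * s ^ ((5:ℝ)/3) := by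
    intro s
    unfold Sf
    rw [hA, hB, hk, Real.rpow_one, show (1 + 2 / 3 : ℝ) = 5 / 3 by norm_num]
    field_simp
    ring
  have φC2 : ContDiff ℝ 2 φ := contDiff_succ_of 1 _ _ hφ1
    (contDiff_one_of _ _ hφ2 (Sc 1 one_pos (by linarith)))
  -- supports
  have φpos : ∀ x, |x| < x₀ → 0 < φ x := by
    have hp : ∀ x, 0 ≤ x → x < x₀ → 0 < φ x := by
      intro x h0 h1
      rcases h0.eq_or_lt with h | h
      · rw [← h, φ0]; exact hM
      · exact (hd x ⟨h, h1⟩).1.1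
    intro x hx
    rcases le_total 0 x with h | h
    · exact hp x h (by rwa [abs_of_nonneg h] at hx)
    · rw [← φe]; exact hp (-x) (by linarith) (by rwa [abs_of_nonpos h] at hx)
  have supp : ∀ f : ℝ → ℝ, (∀ x, f x = 0 ↔ φ x = 0) → tsupport f = Set.Icc (-x₀) x₀ := by
    intro f hf
    have : Function.support f = Set.Ioo (-x₀) x₀ := by
      ext x
      rw [Function.mem_support, Set.mem_Ioo, ← abs_lt, Ne, hf]
      constructor
      · intro h; by_contra h'; exact h (hz x (not_lt.1 h'))
      · intro h; exact (φpos x h).ne'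
    rw [tsupport, this, closure_Ioo (by linarith)]
  have φs := supp φ (fun x => Iff.rfl)
  -- `ψ`
  have ψe : psiOf γ φ = fun x => -(g * φ x ^ ((2:ℝ)/3)) := by
    funext x
    unfold psiOf
    rw [Real.div_rpow (by positivity) hγ.le, ← Real.rpow_natCast, ← Real.rpow_mul (φnn x), hg,
      neg_div, Real.rpow_neg hγ.le]
    push_cast
    rw [show (2 * (1 / 3) : ℝ) = 2 / 3 by norm_num, div_eq_inv_mul]
  have ψs : tsupport (psiOf γ φ) = Set.Icc (-x₀) x₀ := by
    apply supp
    intro x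
    rw [ψe]
    simp only [neg_eq_zero, mul_eq_zero, gpos.ne', false_or]
    exact Real.rpow_eq_zero (φnn x) (by norm_num)
  have φcs : HasCompactSupport φ := by rw [HasCompactSupport, φs]; exact isCompact_Icc
  have ψcs : HasCompactSupport (psiOf γ φ) := by rw [HasCompactSupport, ψs]; exact isCompact_Icc
  have ψ1 : ∀ x, HasDerivAt (psiOf γ φ) (-(g * (2 / 3 * Df A B k p φ (2 / 3) x))) x := by
    intro x
    rw [ψe]
    exact ((first (2 / 3) (by norm_num) (by linarith) x).const_mul g).neg
  have Dc23 := Dc (2 / 3) (by norm_num) (by linarith)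
  have ψC1 : ContDiff ℝ 1 (psiOf γ φ) := contDiff_one_of _ _ ψ1 (by fun_prop)
  have dψ1 : deriv (psiOf γ φ) = fun x => -(g * (2 / 3 * Df A B k p φ (2 / 3) x)) :=
    funext fun x => (ψ1 x).deriv
  have g3 : g ^ 3 * γ = 1 := by
    rw [hg, ← Real.rpow_natCast, ← Real.rpow_mul hγ.le]
    norm_num
    rw [Real.rpow_neg_one]; field_simp
  have bd : ∀ f : ℝ → ℝ, Continuous f → HasCompactSupport f → ∃ C, ∀ x, |f x| ≤ C := by
    intro f h1 h2
    obtain ⟨C, hC⟩ := h1.bounded_above_of_compact_support h2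
    exact ⟨C, hC⟩
  refine ⟨x₀, hx₀, φ, ?_, φnn, φe, φa, φC2, ?_, φs, ?_, ?_, ⟨ψC1, ?_, ψs, ?_, ?_⟩, ?_⟩
  · intro h; rw [h] at φ0; simp at φ0; linarith
  · obtain ⟨C0, h0⟩ := bd φ φc φcs
    obtain ⟨C1, h1⟩ := bd (deriv φ) (by rw [d1]; exact Dc 1 one_pos (by linarith)) φcs.deriv
    obtain ⟨C2, h2⟩ := bd (deriv (deriv φ)) (by rw [d2]; exact Sc 1 one_pos (by linarith))
      φcs.deriv.deriv
    exact ⟨max C0 (max C1 C2), fun x => ⟨(h0 x).trans (by simp), (h1 x).trans (by simp),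
      (h2 x).trans (by simp)⟩⟩
  · intro x; rw [d2]; exact hS _
  · intro x
    rcases le_total 0 x with h | h
    · exact φa (by simp) h h
    · rw [← φe x]; exact φa (by simp) (by simpa using h) (by linarith)
  · obtain ⟨C0, h0⟩ := bd _ ψC1.continuous ψcs
    obtain ⟨C1, h1⟩ := bd (deriv (psiOf γ φ)) (by rw [dψ1]; fun_prop) ψcs.deriv
    exact ⟨max C0 C1, fun x => ⟨(h0 x).trans (by simp), (h1 x).trans (by simp)⟩⟩
  · intro x
    have e : φ x ^ ((5:ℝ)/3) = φ x * φ x ^ ((2:ℝ)/3) := by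
      rw [show (5:ℝ)/3 = 1 + 2 / 3 by norm_num, Real.rpow_add_of_nonneg (φnn x) (by norm_num)
        (by norm_num), Real.rpow_one]
    rw [d2, ψe]
    simp only [hS, e]
    ring
  · intro x
    rw [ψe]
    have e : (φ x ^ ((2:ℝ)/3)) ^ 3 = φ x ^ 2 := by
      rw [← Real.rpow_natCast, ← Real.rpow_mul (φnn x), ← Real.rpow_natCast]; norm_num
    simp only
    calc φ x ^ 2 = (g ^ 3 * γ) * (φ x ^ ((2:ℝ)/3)) ^ 3 := by rw [g3, e, one_mul]
      _ = _ := by ring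
  · intro hp
    have hφ3 : ∀ x, HasDerivAt (fun x => Sf A B k p 1 (φ x))
        (a * ((p + 1) * Df A B k p φ (p + 1) x) + ω * Df A B k p φ 1 x
          - g * (5 / 3 * Df A B k p φ (5 / 3) x)) x := by
      intro x
      simp only [hS]
      exact (((first (p + 1) (by linarith) (by linarith) x).const_mul a).add
        ((hφ1 x).const_mul ω)).sub ((first (5 / 3) (by norm_num) (by linarith) x).const_mul g)
    have c1 := Dc (p + 1) (by linarith) (by linarith)
    have c2 := Dc 1 one_pos (by linarith)
    have c3 := Dc (5 / 3) (by norm_num) (by linarith)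
    have d3 := funext fun x => (hφ3 x).deriv
    have ψ2 : ∀ x, HasDerivAt (fun x => -(g * (2 / 3 * Df A B k p φ (2 / 3) x)))
        (-(g * (2 / 3 * Sf A B k p (2 / 3) (φ x)))) x := fun x =>
      (((second (2 / 3) (by norm_num) (by linarith) x).const_mul (2 / 3)).const_mul g).neg
    have s1 := Sc (2 / 3) (by norm_num) (by linarith)
    have dψ2 := funext fun x => (ψ2 x).deriv
    refine ⟨?_, ?_, ?_, ?_⟩
    · exact contDiff_succ_of 2 _ _ hφ1 (contDiff_succ_of 1 _ _ hφ2
        (contDiff_one_of _ _ hφ3 (by fun_prop)))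
    · refine bd _ ?_ φcs.deriv.deriv.deriv
      rw [d2, d3]; fun_prop
    · exact contDiff_succ_of 1 _ _ ψ1 (contDiff_one_of _ _ ψ2 (by fun_prop))
    · refine bd _ ?_ ψcs.deriv.deriv
      rw [dψ1, dψ2]; fun_prop
end
end

section
/- Let a, γ, ω > 0 and 0 ≤ p ≤ 2/3, with γ^{-1/3} > a in the case p = 2/3. Then there exists a function φ ∈ C³(ℝ), positive, even and decreasing on [0,∞), satisfying -φ''(x) = -a φ(x)^{p+1} - ω φ(x) + γ^{-1/3} φ(x)^{5/3} for all x ∈ ℝ, together with constants C, δ > 0 such that φ(x), |φ'(x)|, |φ''(x)| ≤ C e^{-δ|x|} for all x. Moreover, ψ := -(φ²/γ)^{1/3} belongs to C²(ℝ) and there exists C' > 0 such that |ψ(x)|, |ψ'(x)|, |ψ''(x)| ≤ C' e^{-(2δ/3)|x|} for all x; the pair (φ,ψ) satisfies -φ'' + ωφ = -φψ - a φ^{p+1} and φ² = -γψ³ on ℝ, giving a standing wave (u,v) = (e^{iωt}φ(x), ψ(x)) of the Benney system iu_t + u_xx = a|u|^p u + uv, v_t - γ(v³)_x = (|u|²)_x.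 -/
open MeasureTheory Filter

noncomputable section

lemma sw_field_lip {h : ℝ → ℝ} {K : NNReal} (hK : LipschitzWith K h) (l m : NNReal) :
    LipschitzWith (max l (m * K)) (fun z : ℝ × ℝ => ((l : ℝ) * z.2, (m : ℝ) * h z.1)) := by
  have e1 : LipschitzWith l (fun z : ℝ × ℝ => (l : ℝ) * z.2) := by
    refine LipschitzWith.of_dist_le_mul fun x y => ?_
    rw [Real.dist_eq, ← mul_sub, abs_mul, NNReal.abs_eq]
    refine mul_le_mul_of_nonneg_left ?_ l.2
    rw [Prod.dist_eq]; exact le_max_right _ _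
  have e2 : LipschitzWith (m * K) (fun z : ℝ × ℝ => (m : ℝ) * h z.1) := by
    refine LipschitzWith.of_dist_le_mul fun x y => ?_
    rw [Real.dist_eq, ← mul_sub, abs_mul, NNReal.abs_eq, NNReal.coe_mul, mul_assoc]
    refine mul_le_mul_of_nonneg_left ?_ m.2
    refine (hK.dist_le_mul x.1 y.1).trans ?_
    refine mul_le_mul_of_nonneg_left ?_ K.2
    rw [Prod.dist_eq]; exact le_max_left _ _
  exact e1.prodMk e2

lemma sw_local {h : ℝ → ℝ} {K : NNReal} (hK : LipschitzWith K h) {B : NNReal}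
    (hB : ∀ x, |h x| ≤ B) (T : NNReal) (hT : 0 < T) :
    ∃ f : ℝ → ℝ × ℝ, f 0 = 0 ∧ ∀ t ∈ Set.Ioo (-(T:ℝ)) T,
      HasDerivAt f ((f t).2, h (f t).1) t := by
  have hT' : (0:ℝ) < T := hT
  have hPL : IsPicardLindelof
      (fun (_ : ℝ) (z : ℝ × ℝ) => (((T⁻¹ : NNReal) : ℝ) * z.2, (T : ℝ) * h z.1))
      (tmin := -(T:ℝ)) (tmax := T) ⟨0, by simp⟩ (0 : ℝ × ℝ) (T * (T * B)) 0 (T * B)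
      (max T⁻¹ (T * K)) := by
    constructor
    · intro t _
      exact (sw_field_lip hK T⁻¹ T).lipschitzOnWith
    · intro x _
      exact continuousOn_const
    · intro t _ z hz
      rw [mem_closedBall_zero_iff] at hz
      refine max_le ?_ ?_
      · show ‖((T⁻¹ : NNReal) : ℝ) * z.2‖ ≤ _
        have h2 : ‖z.2‖ ≤ ((T * (T * B) : NNReal) : ℝ) := (le_max_right _ _).trans hz
        rw [norm_mul, Real.norm_eq_abs, NNReal.abs_eq]
        push_cast at h2 ⊢
        rw [inv_mul_le_iff₀ hT']
        exact h2
      · show ‖(T : ℝ) * h z.1‖ ≤ _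
        rw [norm_mul, Real.norm_eq_abs, NNReal.abs_eq]
        push_cast
        exact mul_le_mul_of_nonneg_left (hB _) T.2
    · simp
      linarith
  obtain ⟨α, h0, hα⟩ := hPL.exists_eq_forall_mem_Icc_hasDerivWithinAt₀
  refine ⟨fun t => ((α t).1, ((T⁻¹ : NNReal) : ℝ) * (α t).2), ?_, ?_⟩
  · simp at h0
    simp [h0]
  · intro t ht
    have hd := (hα t (Set.Ioo_subset_Icc_self ht)).hasDerivAt (Icc_mem_nhds ht.1 ht.2)
    have d1 : HasDerivAt (fun t => (α t).1) _ t := hd.fst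
    have d2 : HasDerivAt (fun t => (α t).2) _ t := hd.snd
    have d3 := d2.const_mul ((T⁻¹ : NNReal) : ℝ)
    convert d1.prodMk d3 using 2
    simp only [NNReal.coe_inv]
    rw [inv_mul_cancel_left₀ hT'.ne']

lemma sw_global {h : ℝ → ℝ} {K : NNReal} (hK : LipschitzWith K h) {B : NNReal}
    (hB : ∀ x, |h x| ≤ B) :
    ∃ u w : ℝ → ℝ, u 0 = 0 ∧ w 0 = 0 ∧ (∀ t, HasDerivAt u (w t) t) ∧
      (∀ t, HasDerivAt w (h (u t)) t) ∧ (∀ t, u (-t) = u t) := by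
  have hex : ∀ n : ℕ, ∃ f : ℝ → ℝ × ℝ, f 0 = 0 ∧ ∀ t ∈ Set.Ioo (-((n:ℝ)+1)) ((n:ℝ)+1),
      HasDerivAt f ((f t).2, h (f t).1) t := by
    intro n
    have := sw_local hK hB ((n : NNReal) + 1) (by positivity)
    simpa using this
  choose f hf0 hf using hex
  have hlip : LipschitzWith (max 1 (1 * K)) (fun z : ℝ × ℝ => (z.2, h z.1)) := by
    simpa using sw_field_lip hK 1 1
  have hmono : ∀ n m : ℕ, n ≤ m → ∀ t ∈ Set.Ioo (-((n:ℝ)+1)) ((n:ℝ)+1), f n t = f m t := by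
    intro n m hnm
    have hnm' : (n:ℝ) ≤ m := by exact_mod_cast hnm
    have hn : (0:ℝ) ≤ n := n.cast_nonneg
    refine ODE_solution_unique_of_mem_Ioo (v := fun _ z => (z.2, h z.1)) (s := fun _ => Set.univ)
      (t₀ := 0) (fun t _ => hlip.lipschitzOnWith) ⟨by linarith, by linarith⟩
      (fun t ht => ⟨hf n t ht, trivial⟩) (fun t ht => ⟨hf m t ?_, trivial⟩) ?_
    · exact ⟨by linarith [ht.1], by linarith [ht.2]⟩
    · rw [hf0, hf0]
  have hmem : ∀ t : ℝ, ∀ n : ℕ, |t| ≤ n → t ∈ Set.Ioo (-((n:ℝ)+1)) ((n:ℝ)+1) := by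
    intro t n hn
    obtain ⟨h1, h2⟩ := abs_le.1 hn
    exact ⟨by linarith, by linarith⟩
  set g : ℝ → ℝ × ℝ := fun t => f ⌈|t|⌉₊ t with hg
  have hgf : ∀ n : ℕ, ∀ t : ℝ, |t| ≤ n → g t = f n t := by
    intro n t ht
    exact hmono _ _ (Nat.ceil_le.2 ht) t (hmem t _ (Nat.le_ceil _))
  have hgd : ∀ t, HasDerivAt g ((g t).2, h (g t).1) t := by
    intro t
    obtain ⟨n, hn⟩ := exists_nat_gt |t|
    rw [hgf n t hn.le]
    refine (hf n t (hmem t n hn.le)).congr_of_eventuallyEq ?_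
    have : ∀ᶠ s : ℝ in nhds t, |s| < n := continuous_abs.continuousAt.eventually (gt_mem_nhds hn)
    filter_upwards [this] with s hs
    exact hgf n s hs.le
  have hg0 : g 0 = 0 := by simp [hg, hf0]
  have d1 : ∀ t : ℝ, HasDerivAt (fun t => (g t).1) (g t).2 t := fun t => (hgd t).fst
  have d2 : ∀ t, HasDerivAt (fun t => (g t).2) (h (g t).1) t := fun t => (hgd t).snd
  refine ⟨fun t => (g t).1, fun t => (g t).2, by simp [hg0], by simp [hg0], d1, d2, ?_⟩
  have heq : (fun t : ℝ => ((g (-t)).1, -(g (-t)).2)) = g := by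
    refine ODE_solution_unique_univ (v := fun _ z => (z.2, h z.1)) (s := fun _ => Set.univ)
      (t₀ := 0) (fun t => hlip.lipschitzOnWith) (fun t => ⟨?_, trivial⟩)
      (fun t => ⟨hgd t, trivial⟩) ?_
    · have e1 : HasDerivAt (fun t => (g (-t)).1) (-(g (-t)).2) t := by
        exact ((d1 (-t)).comp t (hasDerivAt_neg t)).congr_deriv (by simp)
      have e2 : HasDerivAt (fun t => -(g (-t)).2) (h (g (-t)).1) t := by
        exact ((d2 (-t)).comp t (hasDerivAt_neg t)).neg.congr_deriv (by simp)
      exact e1.prodMk e2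
    · simp [hg0]
  intro t
  have := congrFun heq t
  exact (Prod.ext_iff.1 this).1

lemma sw_exp_lip (c : ℝ) (hc : 0 ≤ c) (x y : ℝ) :
    |Real.exp (c * min x 0) - Real.exp (c * min y 0)| ≤ c * |x - y| := by
  have key : ∀ s t : ℝ, s ≤ 0 → t ≤ 0 → |Real.exp t - Real.exp s| ≤ |t - s| := by
    intro s t hs ht
    have := Convex.norm_image_sub_le_of_norm_deriv_le (f := Real.exp) (s := Set.Iic 0) (C := 1)
      (fun x _ => Real.differentiableAt_exp) (fun x hx => by
        rw [Real.deriv_exp, Real.norm_of_nonneg (Real.exp_pos x).le]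
        exact Real.exp_le_one_iff.2 hx) (convex_Iic 0) (x := s) (y := t) hs ht
    simpa using this
  refine (key _ _ (mul_nonpos_of_nonneg_of_nonpos hc (min_le_right _ _))
    (mul_nonpos_of_nonneg_of_nonpos hc (min_le_right _ _))).trans ?_
  rw [← mul_sub, abs_mul, abs_of_nonneg hc]
  refine mul_le_mul_of_nonneg_left ?_ hc
  have := abs_min_sub_min_le_max x 0 y 0
  simpa using this

lemma sw_core (p ω P : ℝ) (hp0 : 0 ≤ p) (hp1 : p ≤ 2/3) (hω : 0 < ω) (hP : 0 ≤ P) :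
    ∃ u w : ℝ → ℝ, (∀ t, HasDerivAt u (w t) t) ∧
      (∀ t, HasDerivAt w ((p * P * Real.exp (p * u t)
        - 2/3 * (ω + P) * Real.exp (2/3 * u t)) / 2) t) ∧
      (∀ t, w t ^ 2 = ω + P * Real.exp (p * u t) - (ω + P) * Real.exp (2/3 * u t)) ∧
      (∀ t, u t ≤ 0) ∧ (∀ t, 0 ≤ t → w t ≤ 0) ∧ (∀ t, u (-t) = u t) ∧
      ∃ δ > (0:ℝ), ∃ c : ℝ, ∀ t, u t ≤ c - δ * |t| := by
  set h : ℝ → ℝ := fun x => (p * P * Real.exp (p * x) - 2/3 * (ω + P) * Real.exp (2/3 * x)) / 2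
    with hh
  set G : ℝ → ℝ := fun x => ω + P * Real.exp (p * x) - (ω + P) * Real.exp (2/3 * x) with hG
  have hpP : 0 ≤ p * P := mul_nonneg hp0 hP
  have hoP : 0 < ω + P := by linarith
  have hGd : ∀ x, HasDerivAt G (2 * h x) x := by
    intro x
    have e : ∀ c : ℝ, HasDerivAt (fun x => Real.exp (c * x)) (Real.exp (c * x) * c) x := by
      intro c
      simpa using ((hasDerivAt_id x).const_mul c).exp
    have := (((e p).const_mul P).const_add ω).sub ((e (2/3)).const_mul (ω + P))
    refine this.congr_deriv ?_
    simp only [hh]; ring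
  have hG0 : G 0 = 0 := by simp [hG]
  have hh0 : h 0 < 0 := by
    simp only [hh, mul_zero, Real.exp_zero]
    nlinarith [mul_le_mul_of_nonneg_right hp1 hP]
  -- lower bound for G on the negative axis
  have hGlow : ∀ x, x ≤ 0 → ω * (1 - Real.exp (2/3 * x)) ≤ G x := by
    intro x hx
    have : Real.exp (2/3 * x) ≤ Real.exp (p * x) := Real.exp_le_exp.2 (by nlinarith)
    simp only [hG]
    nlinarith [mul_le_mul_of_nonneg_left this hP]
  set h1 : ℝ → ℝ := fun x => h (min x 0) with hh1
  have hlip : LipschitzWith (Real.toNNReal ((p * P * p + 2/3 * (ω + P) * (2/3)) / 2)) h1 := by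
    refine LipschitzWith.of_dist_le_mul fun x y => ?_
    rw [Real.coe_toNNReal _ (by positivity), Real.dist_eq, Real.dist_eq]
    have i1 := mul_le_mul_of_nonneg_left (sw_exp_lip p hp0 x y) hpP
    have i2 := mul_le_mul_of_nonneg_left (sw_exp_lip (2/3) (by norm_num) x y)
      (show 0 ≤ 2/3 * (ω + P) by positivity)
    have e : h1 x - h1 y = (p * P * (Real.exp (p * min x 0) - Real.exp (p * min y 0))
      - 2/3 * (ω + P) * (Real.exp (2/3 * min x 0) - Real.exp (2/3 * min y 0))) / 2 := by
      simp only [hh1, hh]; ring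
    rw [e, abs_div, abs_two]
    have := abs_sub (p * P * (Real.exp (p * min x 0) - Real.exp (p * min y 0)))
      (2/3 * (ω + P) * (Real.exp (2/3 * min x 0) - Real.exp (2/3 * min y 0)))
    rw [abs_mul (p * P), abs_mul (2/3 * (ω + P)), abs_of_nonneg hpP,
      abs_of_nonneg (show 0 ≤ 2/3 * (ω + P) by positivity)] at this
    rw [div_le_iff₀ (by norm_num)]
    linarith
  have hbd : ∀ x, |h1 x| ≤ (Real.toNNReal (p * P + (ω + P)) : NNReal) := by
    intro x
    rw [Real.coe_toNNReal _ (by positivity)]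
    have a1 : Real.exp (p * min x 0) ≤ 1 :=
      Real.exp_le_one_iff.2 (mul_nonpos_of_nonneg_of_nonpos hp0 (min_le_right _ _))
    have a2 : Real.exp (2/3 * min x 0) ≤ 1 :=
      Real.exp_le_one_iff.2 (mul_nonpos_of_nonneg_of_nonpos (by norm_num) (min_le_right _ _))
    have a3 := Real.exp_pos (p * min x 0)
    have a4 := Real.exp_pos (2/3 * min x 0)
    have b1 := mul_le_mul_of_nonneg_left a1 hpP
    have b2 := mul_le_mul_of_nonneg_left a2 hoP.le
    have b3 := mul_nonneg hpP a3.le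
    have b4 := mul_nonneg hoP.le a4.le
    simp only [hh1, hh]
    rw [abs_le]
    constructor <;> nlinarith
  obtain ⟨u, w, hu0, hw0, hu, hw, heven⟩ := sw_global hlip hbd
  have hc1 : Continuous h1 := hlip.continuous
  -- truncated energy
  set E : ℝ → ℝ := fun x => ∫ s in (0:ℝ)..x, 2 * h1 s with hE
  have hEd : ∀ x, HasDerivAt E (2 * h1 x) x := by
    intro x
    have hc : Continuous fun s => 2 * h1 s := continuous_const.mul hc1
    exact intervalIntegral.integral_hasDerivAt_right (hc.intervalIntegrable _ _)
      (hc.stronglyMeasurableAtFilter _ _) hc.continuousAt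
  have hEneg : ∀ x, x ≤ 0 → E x = G x := by
    intro x hx
    have : E x = ∫ s in (0:ℝ)..x, 2 * h s := by
      refine intervalIntegral.integral_congr fun s hs => ?_
      rw [Set.uIcc_of_ge hx] at hs
      simp only [hh1]
      rw [min_eq_left hs.2]
    rw [this, intervalIntegral.integral_eq_sub_of_hasDerivAt (fun s _ => hGd s), hG0, sub_zero]
    apply Continuous.intervalIntegrable
    simp only [hh]; fun_prop
  have hEpos : ∀ x, 0 < x → E x < 0 := by
    intro x hx
    have : E x = ∫ s in (0:ℝ)..x, 2 * h 0 := by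
      refine intervalIntegral.integral_congr fun s hs => ?_
      rw [Set.uIcc_of_le hx.le] at hs
      simp only [hh1]
      rw [min_eq_right hs.1]
    rw [this, intervalIntegral.integral_const, smul_eq_mul]
    nlinarith
  have hEn : ∀ t, w t ^ 2 = E (u t) := by
    have hd : ∀ t, HasDerivAt (fun t => w t ^ 2 - E (u t)) 0 t := by
      intro t
      have := ((hw t).pow 2).sub ((hEd (u t)).comp t (hu t))
      refine this.congr_deriv ?_
      push_cast; ring
    intro t
    have := is_const_of_deriv_eq_zero (fun t => (hd t).differentiableAt)
      (fun t => (hd t).deriv) t 0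
    simp only [hu0, hw0] at this
    have e0 : E 0 = 0 := by rw [hEneg 0 le_rfl, hG0]
    rw [e0] at this
    linarith
  have hu_np : ∀ t, u t ≤ 0 := by
    intro t
    by_contra hcon
    push Not at hcon
    have := hEpos _ hcon
    nlinarith [hEn t, sq_nonneg (w t)]
  have henergy : ∀ t, w t ^ 2 = G (u t) := fun t => by rw [hEn, hEneg _ (hu_np t)]
  have hw' : ∀ t, HasDerivAt w (h (u t)) t := by
    intro t
    have := hw t
    simp only [hh1] at this
    rwa [min_eq_left (hu_np t)] at this
  have hwz : ∀ t, w t = 0 → u t = 0 := by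
    intro t ht
    by_contra hne
    have hlt : u t < 0 := lt_of_le_of_ne (hu_np t) hne
    have h2 := hGlow _ hlt.le
    rw [← henergy, ht] at h2
    have : Real.exp (2/3 * u t) < 1 := Real.exp_lt_one_iff.2 (by linarith)
    nlinarith
  have hucont : Continuous u := continuous_iff_continuousAt.2 fun t => (hu t).continuousAt
  have hwcont : Continuous w := continuous_iff_continuousAt.2 fun t => (hw' t).continuousAt
  have hwne : ∀ t, 0 < t → w t ≠ 0 := by
    intro t1 ht1 hz
    have hut1 := hwz t1 hz
    obtain ⟨m, hm, hmin⟩ := isCompact_Icc.exists_isMinOn (Set.nonempty_Icc.2 ht1.le)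
      hucont.continuousOn
    have hum : u m = 0 := by
      rcases eq_or_lt_of_le hm.1 with e | l1
      · rw [← e, hu0]
      rcases eq_or_lt_of_le hm.2 with e | l2
      · rw [e, hut1]
      exact hwz m ((hmin.isLocalMin (Icc_mem_nhds l1 l2)).hasDerivAt_eq_zero (hu m))
    have hconst : ∀ s ∈ Set.Icc 0 t1, u s = 0 := fun s hs =>
      le_antisymm (hu_np s) (hum ▸ hmin hs)
    have hws : ∀ s ∈ Set.Ioo 0 t1, w s = 0 := by
      intro s hs
      have := henergy s
      rw [hconst s ⟨hs.1.le, hs.2.le⟩, hG0] at this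
      exact pow_eq_zero_iff (two_ne_zero) |>.1 this
    have hmid : t1/2 ∈ Set.Ioo 0 t1 := ⟨by linarith, by linarith⟩
    have hev : w =ᶠ[nhds (t1/2)] fun _ => 0 := by
      filter_upwards [Ioo_mem_nhds hmid.1 hmid.2] with s hs using hws s hs
    have := (hw' (t1/2)).unique ((hasDerivAt_const (t1/2) (0:ℝ)).congr_of_eventuallyEq hev)
    rw [hconst _ ⟨hmid.1.le, hmid.2.le⟩] at this
    linarith
  have hneg1 : ∃ t, 0 < t ∧ w t < 0 := by
    by_contra hcon
    push Not at hcon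
    have hpos : ∀ t, 0 < t → 0 < w t := fun t ht => lt_of_le_of_ne (hcon t ht) (hwne t ht).symm
    have : StrictMonoOn u (Set.Ici 0) := by
      refine strictMonoOn_of_deriv_pos (convex_Ici 0) hucont.continuousOn fun x hx => ?_
      rw [interior_Ici] at hx
      rw [(hu x).deriv]
      exact hpos x hx
    have := this (show (0:ℝ) ∈ Set.Ici 0 by simp) (show (1:ℝ) ∈ Set.Ici 0 by simp) one_pos
    rw [hu0] at this
    linarith [hu_np 1]
  have hwneg : ∀ t, 0 < t → w t < 0 := by
    intro t ht
    by_contra hcon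
    push Not at hcon
    obtain ⟨s, hs, hws⟩ := hneg1
    obtain ⟨r, hr, hr0⟩ := isPreconnected_Ioi.intermediate_value (a := s) (b := t)
      (s := Set.Ioi 0) hs ht hwcont.continuousOn ⟨hws.le, hcon⟩
    exact hwne r hr hr0
  have hanti : AntitoneOn u (Set.Ici 0) := by
    refine antitoneOn_of_deriv_nonpos (convex_Ici 0) hucont.continuousOn
      (fun x _ => (hu x).differentiableAt.differentiableWithinAt) fun x hx => ?_
    rw [interior_Ici] at hx
    rw [(hu x).deriv]
    exact (hwneg x hx).le
  have hu1 : u 1 < 0 := by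
    refine lt_of_le_of_ne (hu_np 1) fun h0 => hwne 1 one_pos ?_
    have := henergy 1
    rw [h0, hG0] at this
    exact pow_eq_zero_iff (two_ne_zero) |>.1 this
  have hκ : 0 < ω * (1 - Real.exp (2/3 * u 1)) := by
    have : Real.exp (2/3 * u 1) < 1 := Real.exp_lt_one_iff.2 (by linarith)
    exact mul_pos hω (by linarith)
  set δ := Real.sqrt (ω * (1 - Real.exp (2/3 * u 1))) with hδ
  have hδ0 : 0 < δ := Real.sqrt_pos.2 hκ
  have hδ2 : δ ^ 2 = ω * (1 - Real.exp (2/3 * u 1)) := Real.sq_sqrt hκ.le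
  have hwδ : ∀ t, 1 ≤ t → w t ≤ -δ := by
    intro t ht
    have l1 : u t ≤ u 1 := hanti (show (1:ℝ) ∈ Set.Ici 0 by simp)
      (show t ∈ Set.Ici 0 from by simp; linarith) ht
    have l2 := hGlow _ (hu_np t)
    have l3 : Real.exp (2/3 * u t) ≤ Real.exp (2/3 * u 1) := Real.exp_le_exp.2 (by linarith)
    have l4 : δ ^ 2 ≤ w t ^ 2 := by
      rw [henergy, hδ2]
      nlinarith
    nlinarith [hwneg t (by linarith)]
  have hdec : ∀ t, 0 ≤ t → u t ≤ δ - δ * t := by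
    intro t ht
    rcases le_total t 1 with h1 | h1
    · nlinarith [hu_np t]
    · have : AntitoneOn (fun t => u t + δ * t) (Set.Ici 1) := by
        have hd : ∀ x, HasDerivAt (fun t => u t + δ * t) (w x + δ) x := by
          intro x
          exact ((hu x).add ((hasDerivAt_id x).const_mul δ)).congr_deriv (by simp)
        refine antitoneOn_of_deriv_nonpos (convex_Ici 1)
          (fun x _ => (hd x).continuousAt.continuousWithinAt)
          (fun x _ => (hd x).differentiableAt.differentiableWithinAt) fun x hx => ?_
        rw [interior_Ici] at hx
        rw [(hd x).deriv]
        linarith [hwδ x (le_of_lt hx)]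
      have := this (show (1:ℝ) ∈ Set.Ici 1 by simp) (show t ∈ Set.Ici 1 from h1) h1
      simp only at this
      linarith
  refine ⟨u, w, hu, hw', henergy, hu_np, ?_, heven, δ, hδ0, δ, ?_⟩
  · intro t ht
    rcases eq_or_lt_of_le ht with e | l
    · rw [← e, hw0]
    · exact (hwneg t l).le
  · intro t
    rcases abs_cases t with ⟨e, h0⟩ | ⟨e, h0⟩
    · rw [e]; exact hdec t h0
    · rw [e, ← heven]; exact hdec (-t) (by linarith)

lemma sw_v0 (p a b ω : ℝ) (hp0 : 0 ≤ p) (hp1 : p ≤ 2/3) (ha : 0 < a) (hb : 0 < b) (hω : 0 < ω)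
    (hcrit : p = 2/3 → a < b) :
    ∃ v : ℝ, ω + 2 * a / (p + 2) * Real.exp (p * v) = 3/4 * b * Real.exp (2/3 * v) := by
  rcases eq_or_lt_of_le hp1 with e | hlt
  · have hab := hcrit e
    have hpos : 0 < 4 * ω / (3 * (b - a)) := by
      have : 0 < b - a := by linarith
      positivity
    refine ⟨3/2 * Real.log (4 * ω / (3 * (b - a))), ?_⟩
    have hne : b - a ≠ 0 := by linarith
    rw [e, show 2/3 * (3/2 * Real.log (4 * ω / (3 * (b - a)))) = Real.log (4 * ω / (3 * (b - a)))
      by ring, Real.exp_log hpos]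
    field_simp
    ring
  · set A := 2 * a / (p + 2) with hA
    have hA0 : 0 < A := by positivity
    set F : ℝ → ℝ := fun v => 3/4 * b * Real.exp (2/3 * v) - A * Real.exp (p * v) - ω with hF
    have hFc : Continuous F := by simp only [hF]; fun_prop
    have h1 : F (3/2 * Real.log (4 * ω / (3 * b))) ≤ 0 := by
      have hpos : 0 < 4 * ω / (3 * b) := by positivity
      simp only [hF]
      rw [show 2/3 * (3/2 * Real.log (4 * ω / (3 * b))) = Real.log (4 * ω / (3 * b))
        by ring, Real.exp_log hpos]
      have : 3/4 * b * (4 * ω / (3 * b)) = ω := by field_simp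
      rw [this]
      have := mul_pos hA0 (Real.exp_pos (p * (3/2 * Real.log (4 * ω / (3 * b)))))
      linarith
    have h2 : ∃ v, 0 ≤ F v := by
      set c := 4 * (A + ω) / (3 * b) with hc
      have hc0 : 0 < c := by positivity
      have hd : 0 < 2/3 - p := by linarith
      refine ⟨max 0 (Real.log c / (2/3 - p)), ?_⟩
      set v := max 0 (Real.log c / (2/3 - p)) with hv
      have hv0 : 0 ≤ v := le_max_left _ _
      have hv1 : Real.log c ≤ (2/3 - p) * v := by
        have : Real.log c / (2/3 - p) ≤ v := le_max_right _ _
        rw [div_le_iff₀ hd] at this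
        linarith
      have hv2 : c ≤ Real.exp ((2/3 - p) * v) := by
        rw [← Real.exp_log hc0]
        exact Real.exp_le_exp.2 hv1
      have hv3 : A + ω ≤ 3/4 * b * Real.exp ((2/3 - p) * v) := by
        calc A + ω = 3/4 * b * c := by rw [hc]; field_simp
          _ ≤ _ := mul_le_mul_of_nonneg_left hv2 (by positivity)
      have hv4 : Real.exp (2/3 * v) = Real.exp ((2/3 - p) * v) * Real.exp (p * v) := by
        rw [← Real.exp_add]; congr 1; ring
      have hv5 : 1 ≤ Real.exp (p * v) := Real.one_le_exp (mul_nonneg hp0 hv0)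
      simp only [hF]
      rw [hv4]
      nlinarith [mul_le_mul_of_nonneg_right hv3 (Real.exp_pos (p * v)).le]
    obtain ⟨v2, h2⟩ := h2
    obtain ⟨v, hv⟩ := mem_range_of_exists_le_of_exists_ge hFc ⟨_, h1⟩ ⟨_, h2⟩
    refine ⟨v, ?_⟩
    simp only [hF] at hv
    linarith

lemma sw_profile {u w h : ℝ → ℝ} (hu : ∀ t, HasDerivAt u (w t) t)
    (hw : ∀ t, HasDerivAt w (h (u t)) t) (hh : ContDiff ℝ 2 h) {M δ c0 : ℝ} (hM : 0 ≤ M)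
    (hwM : ∀ t, |w t| ≤ M) (hhM : ∀ t, |h (u t)| ≤ M) (hdec : ∀ t, u t ≤ c0 - δ * |t|)
    (κ c : ℝ) (hc : 0 ≤ c) :
    ContDiff ℝ 3 (fun t => κ * Real.exp (c * u t)) ∧
    (deriv (fun t => κ * Real.exp (c * u t)) = fun t => κ * Real.exp (c * u t) * (c * w t)) ∧
    (deriv (deriv (fun t => κ * Real.exp (c * u t)))
      = fun t => κ * Real.exp (c * u t) * (c ^ 2 * w t ^ 2 + c * h (u t))) ∧
    ∃ C > (0:ℝ), ∀ x, |κ * Real.exp (c * u x)| ≤ C * Real.exp (-(c * δ) * |x|) ∧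
      |deriv (fun t => κ * Real.exp (c * u t)) x| ≤ C * Real.exp (-(c * δ) * |x|) ∧
      |deriv (deriv (fun t => κ * Real.exp (c * u t))) x| ≤ C * Real.exp (-(c * δ) * |x|) := by
  have hdu : deriv u = w := funext fun t => (hu t).deriv
  have hdw : deriv w = fun t => h (u t) := funext fun t => (hw t).deriv
  have hud : Differentiable ℝ u := fun t => (hu t).differentiableAt
  have hwd : Differentiable ℝ w := fun t => (hw t).differentiableAt
  have hw1 : ContDiff ℝ 1 w := by
    rw [contDiff_one_iff_deriv, hdw]
    exact ⟨hwd, hh.continuous.comp hud.continuous⟩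
  have hu2 : ContDiff ℝ 2 u := by
    rw [show (2 : WithTop ℕ∞) = 1 + 1 by norm_num, contDiff_succ_iff_deriv, hdu]
    exact ⟨hud, by simp, hw1⟩
  have hw2 : ContDiff ℝ 2 w := by
    rw [show (2 : WithTop ℕ∞) = 1 + 1 by norm_num, contDiff_succ_iff_deriv, hdw]
    exact ⟨hwd, by simp, (hh.comp hu2).of_le (by norm_num)⟩
  have hu3 : ContDiff ℝ 3 u := by
    rw [show (3 : WithTop ℕ∞) = 2 + 1 by norm_num, contDiff_succ_iff_deriv, hdu]
    exact ⟨hud, by simp, hw2⟩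
  have e1 : ∀ t, HasDerivAt (fun t => κ * Real.exp (c * u t)) (κ * Real.exp (c * u t) * (c * w t)) t := by
    intro t
    exact (((hu t).const_mul c).exp.const_mul κ).congr_deriv (by ring)
  have e2 : ∀ t, HasDerivAt (fun t => κ * Real.exp (c * u t) * (c * w t))
      (κ * Real.exp (c * u t) * (c ^ 2 * w t ^ 2 + c * h (u t))) t := by
    intro t
    exact ((e1 t).mul ((hw t).const_mul c)).congr_deriv (by ring)
  have d1 : deriv (fun t => κ * Real.exp (c * u t)) = fun t => κ * Real.exp (c * u t) * (c * w t) :=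
    funext fun t => (e1 t).deriv
  have d2 : deriv (deriv (fun t => κ * Real.exp (c * u t)))
      = fun t => κ * Real.exp (c * u t) * (c ^ 2 * w t ^ 2 + c * h (u t)) := by
    rw [d1]; exact funext fun t => (e2 t).deriv
  refine ⟨contDiff_const.mul (contDiff_const.mul hu3).exp, d1, d2, ?_⟩
  rw [d2, d1]
  set D := |κ| * Real.exp (c * c0) with hD
  have hD0 : 0 ≤ D := by positivity
  have hB : ∀ x, |κ * Real.exp (c * u x)| ≤ D * Real.exp (-(c * δ) * |x|) := by
    intro x
    rw [abs_mul, Real.abs_exp, hD, mul_assoc, ← Real.exp_add]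
    refine mul_le_mul_of_nonneg_left (Real.exp_le_exp.2 ?_) (abs_nonneg _)
    nlinarith [mul_le_mul_of_nonneg_left (hdec x) hc]
  set N := 1 + c * M + (c ^ 2 * M ^ 2 + c * M) with hN
  have hcM : 0 ≤ c * M := by positivity
  have hcM2 : 0 ≤ c ^ 2 * M ^ 2 := by positivity
  have key : ∀ x r : ℝ, |r| ≤ N → |κ * Real.exp (c * u x) * r|
      ≤ (D * N + 1) * Real.exp (-(c * δ) * |x|) := by
    intro x r hr
    rw [abs_mul]
    have := mul_le_mul (hB x) hr (abs_nonneg _) (by positivity)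
    nlinarith [Real.exp_pos (-(c * δ) * |x|)]
  refine ⟨D * N + 1, by positivity, fun x => ⟨?_, key x _ ?_, key x _ ?_⟩⟩
  · have := key x 1 (by rw [abs_one]; linarith)
    rwa [mul_one] at this
  · rw [abs_mul, abs_of_nonneg hc]
    nlinarith [mul_le_mul_of_nonneg_left (hwM x) hc]
  · refine (abs_add_le _ _).trans ?_
    rw [abs_mul, abs_mul, abs_of_nonneg hc, abs_of_nonneg (sq_nonneg c), abs_of_nonneg (sq_nonneg (w x))]
    have i1 : w x ^ 2 ≤ M ^ 2 := sq_le_sq' (by linarith [(abs_le.1 (hwM x)).1]) (abs_le.1 (hwM x)).2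
    nlinarith [mul_le_mul_of_nonneg_left (hhM x) hc, mul_le_mul_of_nonneg_left i1 (sq_nonneg c)]

/-- for `0 ≤ p ≤ 2/3` (with `γ^{-1/3} > a` if `p = 2/3`) and
`a, γ, ω > 0`, the Benney system admits a positive, even, radially decreasing
standing-wave profile `φ ∈ C³(ℝ)` solving
`-φ'' = -aφ^{p+1} - ωφ + γ^{-1/3}φ^{5/3}`, decaying exponentially together with
`φ'` and `φ''`; moreover `ψ := -(φ²/γ)^{1/3} ∈ C²(ℝ)` decays exponentially at
rate `2δ/3` together with `ψ'`, `ψ''`, and `(φ,ψ)` satisfies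
`-φ'' + ωφ = -φψ - aφ^{p+1}`, `φ² = -γψ³`. -/
theorem standing_wave_exists (p a γ ω : ℝ) (hp0 : 0 ≤ p) (hp1 : p ≤ 2/3)
    (ha : 0 < a) (hγ : 0 < γ) (hω : 0 < ω)
    (hcrit : p = 2/3 → a < γ ^ (-(1:ℝ)/3)) :
    ∃ φ : ℝ → ℝ,
      ContDiff ℝ 3 φ ∧ (∀ x, 0 < φ x) ∧ (∀ x, φ (-x) = φ x) ∧
      AntitoneOn φ (Set.Ici 0) ∧
      (∀ x, -deriv (deriv φ) x
        = -a * φ x ^ (p + 1) - ω * φ x + γ ^ (-(1:ℝ)/3) * φ x ^ ((5:ℝ)/3)) ∧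
      ∃ C > (0:ℝ), ∃ δ > (0:ℝ),
        (∀ x, φ x ≤ C * Real.exp (-δ * |x|) ∧
          |deriv φ x| ≤ C * Real.exp (-δ * |x|) ∧
          |deriv (deriv φ) x| ≤ C * Real.exp (-δ * |x|)) ∧
        ContDiff ℝ 2 (psiOf γ φ) ∧
        (∃ C' > (0:ℝ), ∀ x,
          |psiOf γ φ x| ≤ C' * Real.exp (-(2*δ/3) * |x|) ∧
          |deriv (psiOf γ φ) x| ≤ C' * Real.exp (-(2*δ/3) * |x|) ∧
          |deriv (deriv (psiOf γ φ)) x| ≤ C' * Real.exp (-(2*δ/3) * |x|)) ∧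
        (∀ x, -deriv (deriv φ) x + ω * φ x
          = -(φ x * psiOf γ φ x) - a * φ x ^ (p + 1)) ∧
        (∀ x, (φ x) ^ 2 = -γ * (psiOf γ φ x) ^ 3) := by

  set b := γ ^ (-(1:ℝ)/3) with hb
  have hb0 : 0 < b := Real.rpow_pos_of_pos hγ _
  obtain ⟨v, hv⟩ := sw_v0 p a b ω hp0 hp1 ha hb0 hω hcrit
  set P := 2 * a / (p + 2) * Real.exp (p * v) with hP
  have hP0 : 0 < P := by positivity
  obtain ⟨u, w, hu, hw, hen, hnp, hwneg, heven, δ, hδ, c0, hdec⟩ :=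
    sw_core p ω P hp0 hp1 hω hP0.le
  set h : ℝ → ℝ := fun x => (p * P * Real.exp (p * x) - 2/3 * (ω + P) * Real.exp (2/3 * x)) / 2
    with hh
  have hhc : ContDiff ℝ 2 h := by simp only [hh]; fun_prop
  have hx1 : ∀ t, Real.exp (p * u t) ≤ 1 := fun t =>
    Real.exp_le_one_iff.2 (mul_nonpos_of_nonneg_of_nonpos hp0 (hnp t))
  have hx2 : ∀ t, Real.exp (2/3 * u t) ≤ 1 := fun t =>
    Real.exp_le_one_iff.2 (mul_nonpos_of_nonneg_of_nonpos (by norm_num) (hnp t))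
  have hpP : 0 ≤ p * P := by positivity
  have hoP : 0 < ω + P := by positivity
  set M := ω + P + p * P + 1 with hM
  have hM1 : 1 ≤ M := by linarith
  have hwM : ∀ t, |w t| ≤ M := by
    intro t
    refine abs_le_of_sq_le_sq ?_ (by linarith)
    rw [hen]
    have := mul_le_mul_of_nonneg_left (hx1 t) hP0.le
    have := mul_pos hoP (Real.exp_pos (2/3 * u t))
    nlinarith
  have hhM : ∀ t, |h (u t)| ≤ M := by
    intro t
    have b1 := mul_le_mul_of_nonneg_left (hx1 t) hpP
    have b2 := mul_le_mul_of_nonneg_left (hx2 t) hoP.le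
    have b3 := mul_nonneg hpP (Real.exp_pos (p * u t)).le
    have b4 := mul_nonneg hoP.le (Real.exp_pos (2/3 * u t)).le
    simp only [hh]
    rw [abs_le]
    constructor <;> linarith
  obtain ⟨f1, f2, f3, C, hC, f4⟩ := sw_profile hu hw hhc (by linarith) hwM hhM hdec
    (Real.exp v) 1 zero_le_one
  obtain ⟨g1, g2, g3, C', hC', g4⟩ := sw_profile hu hw hhc (by linarith) hwM hhM hdec
    (-(b * Real.exp (2/3 * v))) (2/3) (by norm_num)
  set φ : ℝ → ℝ := fun t => Real.exp v * Real.exp (1 * u t) with hφ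
  have hφe : ∀ t, φ t = Real.exp (u t + v) := by
    intro t; simp only [hφ]; rw [← Real.exp_add]; congr 1; ring
  have hpow : ∀ t q, φ t ^ q = Real.exp (q * u t) * Real.exp (q * v) := by
    intro t q
    rw [hφe, ← Real.exp_mul, ← Real.exp_add]; congr 1; ring
  have hφ0 : ∀ t, 0 < φ t := fun t => by rw [hφe]; exact Real.exp_pos _
  have hψb : ∀ t, psiOf γ φ t = -(b * φ t ^ ((2:ℝ)/3)) := by
    intro t
    simp only [psiOf]
    rw [div_eq_mul_inv, Real.mul_rpow (sq_nonneg _) (inv_nonneg.2 hγ.le), ← Real.rpow_natCast,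
      ← Real.rpow_mul (hφ0 t).le, Real.inv_rpow hγ.le, ← Real.rpow_neg hγ.le, hb]
    norm_num [mul_comm]
  have hψ : psiOf γ φ = fun t => -(b * Real.exp (2/3 * v)) * Real.exp (2/3 * u t) := by
    funext t
    rw [hψb, hpow]; ring
  have hode : ∀ x, -deriv (deriv φ) x
        = -a * φ x ^ (p + 1) - ω * φ x + b * φ x ^ ((5:ℝ)/3) := by
    intro x
    rw [f3]
    have q1 : φ x ^ (p + 1) = φ x * (Real.exp (p * u x) * Real.exp (p * v)) := by
      rw [Real.rpow_add (hφ0 x), hpow x p, Real.rpow_one]; ring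
    have q2 : φ x ^ ((5:ℝ)/3) = φ x * (Real.exp (2/3 * u x) * Real.exp (2/3 * v)) := by
      rw [show (5:ℝ)/3 = 2/3 + 1 by norm_num, Real.rpow_add (hφ0 x), hpow x (2/3), Real.rpow_one]
      ring
    rw [q1, q2]
    show -(φ x * (1 ^ 2 * w x ^ 2 + 1 * h (u x))) = _
    rw [hen]
    simp only [hh]
    have r1 : a * Real.exp (p * v) = P * (p + 2) / 2 := by
      rw [hP]; field_simp
    have r2 : b * Real.exp (2/3 * v) = 4/3 * (ω + P) := by rw [hv]; ring
    linear_combination (-(φ x * Real.exp (p * u x))) * (-r1) + (φ x * Real.exp (2/3 * u x)) * (-r2)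
  refine ⟨φ, f1, hφ0, ?_, ?_, hode, C, hC, δ, hδ, ?_, ?_, ⟨C', hC', ?_⟩, ?_, ?_⟩
  · intro x; rw [hφe, hφe, heven]
  · refine antitoneOn_of_deriv_nonpos (convex_Ici 0) f1.continuous.continuousOn
      (f1.differentiable (by norm_num)).differentiableOn fun x hx => ?_
    rw [interior_Ici] at hx
    rw [f2]
    exact mul_nonpos_of_nonneg_of_nonpos (hφ0 x).le (by linarith [hwneg x (le_of_lt hx)])
  · intro x
    have := f4 x
    rw [one_mul δ] at this
    exact ⟨(le_abs_self _).trans this.1, this.2.1, this.2.2⟩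
  · rw [hψ]; exact g1.of_le (by norm_num)
  · intro x
    rw [hψ, show 2 * δ / 3 = 2/3 * δ by ring]
    exact g4 x
  · intro x
    rw [hode, hψb, show (5:ℝ)/3 = 2/3 + 1 by norm_num, Real.rpow_add (hφ0 x) (2/3), Real.rpow_one]
    ring
  · intro x
    have hnn : 0 ≤ φ x ^ 2 / γ := by positivity
    simp only [psiOf]
    have : (((φ x) ^ 2 / γ) ^ ((1:ℝ)/3)) ^ 3 = φ x ^ 2 / γ := by
      rw [← Real.rpow_natCast, ← Real.rpow_mul hnn]; norm_num
    rw [show ∀ z : ℝ, -γ * (-z) ^ 3 = γ * z ^ 3 from fun z => by ring, this]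
    field_simp
end
end
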